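/- Theorem A.1, expectation-form hypotheses (a strengthening implicit in the proof): let d^H : Fin S → Σ be a fixed document, let ε ≥ 0 be a real number, and let B, H, B', H', L be autoregressive models over Σ of length S. Assume: (Semantic Superiority) PPL(d^H, H) ≤ PPL(d^H, B); (Conditional Redundancy in expectation) ∑_{d : Fin S → Σ} P_L(d) · PPL(d, H') ≤ PPL(d^H, H); (Bounded Perplexity in expectation) ∑_{d : Fin S → Σ} P_L(d) · ( PPL(d, B) − PPL(d, B') ) ≤ ε; and (KL alignment) for every s < S and every prefix p : Fin s → Σ, D_KL( L_s(·|p) ‖ B'_s(·|p) ) + ε ≤ D_KL( L_s(·|p) ‖ H'_s(·|p) ). Then ∑_{d : Fin S → Σ} P_L(d) · ( PPL(d, B) − PPL(d^H, B) ) ≤ 0. -/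

import Mathlib

open Finset

/-- An autoregressive model over a finite token alphabet `Tok` of length `S`:
for each position `s < S` and each prefix `p : Fin s → Tok`, a strictly positive
conditional probability mass function on `Tok`. -/
structure ARModel (Tok : Type*) [Fintype Tok] (S : ℕ) where
  prob : ∀ s : Fin S, (Fin s → Tok) → Tok → ℝ
  prob_pos : ∀ (s : Fin S) (p : Fin s → Tok) (x : Tok), 0 < prob s p x
  sum_prob : ∀ (s : Fin S) (p : Fin s → Tok), ∑ x, prob s p x = 1

/-- The prefix `(d_0, …, d_{s-1})` of a document `d`. -/
def prefixOf {Tok : Type*} {S : ℕ} (d : Fin S → Tok) (s : Fin S) : Fin s → Tok :=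
  fun t => d ⟨t.1, t.2.trans s.isLt⟩

/-- Joint probability of a document `d` under the autoregressive model `M`. -/
noncomputable def joint {Tok : Type*} [Fintype Tok] {S : ℕ}
    (M : ARModel Tok S) (d : Fin S → Tok) : ℝ :=
  ∏ s : Fin S, M.prob s (prefixOf d s) (d s)

/-- Log-perplexity of a document `d` under the autoregressive model `M`. -/
noncomputable def ppl {Tok : Type*} [Fintype Tok] {S : ℕ}
    (M : ARModel Tok S) (d : Fin S → Tok) : ℝ :=
  -(1 / (S : ℝ)) * ∑ s : Fin S, Real.log (M.prob s (prefixOf d s) (d s))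

/-- Marginal probability of a prefix `p : Fin s → Tok` under the model `M`. -/
noncomputable def prefixMarginal {Tok : Type*} [Fintype Tok] {S : ℕ}
    (M : ARModel Tok S) (s : Fin S) (p : Fin s → Tok) : ℝ :=
  ∏ t : Fin s, M.prob ⟨t.1, t.2.trans s.isLt⟩ (fun u => p ⟨u.1, u.2.trans t.2⟩) (p t)

/-- Kullback–Leibler divergence between two (strictly positive) probability
vectors on `Tok`. -/
noncomputable def klDiv {Tok : Type*} [Fintype Tok] (p q : Tok → ℝ) : ℝ :=
  ∑ x, p x * Real.log (p x / q x)

namespace ARModel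

variable {Tok : Type*} [Fintype Tok] {S : ℕ}

/-- The model obtained by forgetting the last position. -/
def dropLast (M : ARModel Tok (S + 1)) : ARModel Tok S where
  prob s p x := M.prob s.castSucc p x
  prob_pos s p x := M.prob_pos s.castSucc p x
  sum_prob s p := M.sum_prob s.castSucc p

end ARModel

section

variable {Tok : Type*} {S : ℕ}

lemma prefixOf_snoc_castSucc (d : Fin S → Tok) (x : Tok) (s : Fin S) :
    prefixOf (Fin.snoc d x : Fin (S + 1) → Tok) s.castSucc = prefixOf d s := by
  funext t
  exact Fin.snoc_castSucc (α := fun _ => Tok) x d ⟨t.1, t.2.trans s.isLt⟩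

lemma prefixOf_snoc_last (d : Fin S → Tok) (x : Tok) :
    prefixOf (Fin.snoc d x : Fin (S + 1) → Tok) (Fin.last S) = d := by
  funext t
  exact Fin.snoc_castSucc (α := fun _ => Tok) x d t

/-- Splitting a sum over documents position by position, the last position being dealt with
separately. -/
lemma sum_pi_eq_sum_snoc [Fintype Tok] (F : (Fin (S + 1) → Tok) → ℝ) :
    ∑ d, F d = ∑ d : Fin S → Tok, ∑ x, F (Fin.snoc d x) := by
  rw [← (Fin.snocEquiv (fun _ : Fin (S + 1) => Tok)).sum_comp, Fintype.sum_prod_type, sum_comm]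
  rfl

lemma sum_positions_snoc (g : ∀ s : Fin (S + 1), (Fin s → Tok) → Tok → ℝ)
    (d : Fin S → Tok) (x : Tok) :
    ∑ s, g s (prefixOf (Fin.snoc d x : Fin (S + 1) → Tok) s)
        ((Fin.snoc d x : Fin (S + 1) → Tok) s) =
      ∑ s : Fin S, g s.castSucc (prefixOf d s) (d s) + g (Fin.last S) d x := by
  rw [Fin.sum_univ_castSucc, Fin.snoc_last, prefixOf_snoc_last]
  simp only [Fin.snoc_castSucc, prefixOf_snoc_castSucc]

variable [Fintype Tok]

lemma joint_snoc (M : ARModel Tok (S + 1)) (d : Fin S → Tok) (x : Tok) :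
    joint M (Fin.snoc d x) = joint M.dropLast d * M.prob (Fin.last S) d x := by
  unfold joint
  rw [Fin.prod_univ_castSucc, Fin.snoc_last, prefixOf_snoc_last]
  simp only [Fin.snoc_castSucc, prefixOf_snoc_castSucc]
  rfl

lemma joint_nonneg (M : ARModel Tok S) (d : Fin S → Tok) : 0 ≤ joint M d :=
  prod_nonneg fun s _ => (M.prob_pos s _ _).le

lemma sum_joint (M : ARModel Tok S) : ∑ d, joint M d = 1 := by
  induction S with
  | zero => simp [joint]
  | succ S ih =>
    simp only [sum_pi_eq_sum_snoc, joint_snoc, ← mul_sum, M.sum_prob, mul_one]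
    exact ih M.dropLast

/-- If every conditional expectation of `g` is at most `c`, then the expectation of the sum of `g`
over the `S` positions is at most `S * c`. -/
lemma sum_joint_mul_sum_le (M : ARModel Tok S) (g : ∀ s : Fin S, (Fin s → Tok) → Tok → ℝ) {c : ℝ}
    (hg : ∀ s p, ∑ x, M.prob s p x * g s p x ≤ c) :
    ∑ d, joint M d * ∑ s, g s (prefixOf d s) (d s) ≤ S * c := by
  induction S with
  | zero => simp
  | succ S ih =>
    have hinit := ih M.dropLast (fun s => g s.castSucc) fun s => hg s.castSucc
    have hlast : ∑ d, joint M.dropLast d * ∑ x, M.prob (Fin.last S) d x * g (Fin.last S) d x ≤ c :=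
      calc
        _ ≤ ∑ d, joint M.dropLast d * c :=
          sum_le_sum fun d _ => mul_le_mul_of_nonneg_left (hg (Fin.last S) d) (joint_nonneg _ d)
        _ = c := by rw [← sum_mul, sum_joint, one_mul]
    have hsplit : ∑ d, joint M d * ∑ s, g s (prefixOf d s) (d s) =
        ∑ d, joint M.dropLast d * ∑ s : Fin S, g s.castSucc (prefixOf d s) (d s) +
          ∑ d, joint M.dropLast d * ∑ x, M.prob (Fin.last S) d x * g (Fin.last S) d x := by
      rw [sum_pi_eq_sum_snoc, ← sum_add_distrib]
      refine sum_congr rfl fun d _ => ?_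
      simp only [sum_positions_snoc, joint_snoc, mul_add, mul_assoc, sum_add_distrib, ← mul_sum]
      rw [← sum_mul, M.sum_prob (Fin.last S) d, one_mul]
    rw [hsplit]
    push_cast
    linarith

lemma sum_mul_log_sub_log {p q r : Tok → ℝ} (hp : ∀ x, 0 < p x) (hq : ∀ x, 0 < q x)
    (hr : ∀ x, 0 < r x) :
    ∑ x, p x * (Real.log (r x) - Real.log (q x)) = klDiv p q - klDiv p r := by
  unfold klDiv
  rw [← sum_sub_distrib]
  refine sum_congr rfl fun x _ => ?_
  rw [Real.log_div (hp x).ne' (hq x).ne', Real.log_div (hp x).ne' (hr x).ne']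
  ring

lemma ppl_sub_ppl (M N : ARModel Tok S) (d : Fin S → Tok) :
    ppl M d - ppl N d = 1 / S * ∑ s, (Real.log (N.prob s (prefixOf d s) (d s)) -
      Real.log (M.prob s (prefixOf d s) (d s))) := by
  unfold ppl
  rw [sum_sub_distrib]
  ring

/-- A uniform conditional KL advantage of `M` over `N` relative to `L` gives the same advantage in
expected log-perplexity under `L`. -/
lemma sum_joint_mul_ppl_sub_le (hS : 1 ≤ S) (L M N : ARModel Tok S) {ε : ℝ}
    (hKL : ∀ s p, klDiv (L.prob s p) (M.prob s p) + ε ≤ klDiv (L.prob s p) (N.prob s p)) :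
    ∑ d, joint L d * (ppl M d - ppl N d) ≤ -ε := by
  have hS0 : (0 : ℝ) < S := by exact_mod_cast hS
  have h := sum_joint_mul_sum_le L
    (fun s p x => Real.log (N.prob s p x) - Real.log (M.prob s p x)) (c := -ε) fun s p => by
      rw [sum_mul_log_sub_log (L.prob_pos s p) (M.prob_pos s p) (N.prob_pos s p)]
      linarith [hKL s p]
  simp only [ppl_sub_ppl, mul_left_comm _ (1 / (S : ℝ)), ← mul_sum]
  rw [one_div, inv_mul_le_iff₀ hS0]
  exact h

end

/-- Theorem A.1 with expectation-form hypotheses. -/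
theorem llm_lower_expected_ppl_expectation_form {Tok : Type*} [Fintype Tok] [DecidableEq Tok]
    [Nonempty Tok] {S : ℕ} (hS : 1 ≤ S) (dH : Fin S → Tok) (ε : ℝ) (hε : 0 ≤ ε)
    (B H B' H' L : ARModel Tok S)
    (hSS : ppl H dH ≤ ppl B dH)
    (hCR : ∑ d : Fin S → Tok, joint L d * ppl H' d ≤ ppl H dH)
    (hBP : ∑ d : Fin S → Tok, joint L d * (ppl B d - ppl B' d) ≤ ε)
    (hKL : ∀ (s : Fin S) (p : Fin s → Tok),
        klDiv (L.prob s p) (B'.prob s p) + ε ≤ klDiv (L.prob s p) (H'.prob s p)) :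
    ∑ d : Fin S → Tok, joint L d * (ppl B d - ppl B dH) ≤ 0 := by
  have hBH := sum_joint_mul_ppl_sub_le hS L B' H' hKL
  simp only [mul_sub, sum_sub_distrib] at hBP hBH ⊢
  rw [← sum_mul, sum_joint, one_mul]
  linarith
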